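/- arXiv:hep-th/0105142 — 10 statements merged into one kernel-verified Lean document; each statement's English description precedes it below -/
import Mathlib

section
/- For every matrix M in SL(2,ℂ) there exist a unique U in SU(2) and a unique vector λ⃗ = (λ₁,λ₂,λ₃) ∈ ℝ³ such that M = U·(√(1+|λ⃗|²)·I₂ + λ₁τ₁ + λ₂τ₂ + λ₃τ₃). -/
open Matrix Complex

noncomputable def tau1 : Matrix (Fin 2) (Fin 2) ℂ := !![0, 1; 1, 0]
noncomputable def tau2 : Matrix (Fin 2) (Fin 2) ℂ := !![0, -Complex.I; Complex.I, 0]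
noncomputable def tau3 : Matrix (Fin 2) (Fin 2) ℂ := !![1, 0; 0, -1]

/-- The Hermitian matrix `√(1+|l|²) I₂ + l₁τ₁ + l₂τ₂ + l₃τ₃` of determinant one. -/
noncomputable def boost (l : Fin 3 → ℝ) : Matrix (Fin 2) (Fin 2) ℂ :=
  (Real.sqrt (1 + (l 0 ^ 2 + l 1 ^ 2 + l 2 ^ 2)) : ℂ) • (1 : Matrix (Fin 2) (Fin 2) ℂ) +
    (l 0 : ℂ) • tau1 + (l 1 : ℂ) • tau2 + (l 2 : ℂ) • tau3

theorem boost_eq {l : Fin 3 → ℝ} {c : ℝ} (hc : 0 ≤ c)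
    (h : c ^ 2 = 1 + (l 0 ^ 2 + l 1 ^ 2 + l 2 ^ 2)) :
    boost l = !![(c + l 2 : ℂ), l 0 - l 1 * I; l 0 + l 1 * I, c - l 2] := by
  rw [boost, ← h, Real.sqrt_sq hc]
  ext i j
  fin_cases i <;> fin_cases j <;> simp [tau1, tau2, tau3, sub_eq_add_neg]

theorem exists_boost_eq (l : Fin 3 → ℝ) :
    ∃ c : ℝ, 0 < c ∧ c ^ 2 = 1 + (l 0 ^ 2 + l 1 ^ 2 + l 2 ^ 2) ∧
      boost l = !![(c + l 2 : ℂ), l 0 - l 1 * I; l 0 + l 1 * I, c - l 2] := by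
  have hpos : 0 < 1 + (l 0 ^ 2 + l 1 ^ 2 + l 2 ^ 2) := by positivity
  have hsq := Real.sq_sqrt hpos.le
  exact ⟨_, Real.sqrt_pos.2 hpos, hsq, boost_eq (Real.sqrt_nonneg _) hsq⟩

theorem conjTranspose_boost (l : Fin 3 → ℝ) : (boost l)ᴴ = boost l := by
  obtain ⟨c, -, -, h⟩ := exists_boost_eq l
  rw [h]
  ext i j
  fin_cases i <;> fin_cases j <;> simp [sub_eq_add_neg]

theorem det_boost (l : Fin 3 → ℝ) : (boost l).det = 1 := by
  obtain ⟨c, -, hc, h⟩ := exists_boost_eq l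
  have hc' : (c : ℂ) ^ 2 = 1 + (l 0 ^ 2 + l 1 ^ 2 + l 2 ^ 2) := by exact_mod_cast hc
  rw [h, det_fin_two_of]
  linear_combination hc' + (l 1 : ℂ) ^ 2 * I_sq

theorem boost_mul_self {l : Fin 3 → ℝ} {c : ℝ} (hc : 0 ≤ c)
    (h : c ^ 2 = 1 + (l 0 ^ 2 + l 1 ^ 2 + l 2 ^ 2)) :
    boost l * boost l = !![(2 * c ^ 2 - 1 + 2 * c * l 2 : ℂ), 2 * c * (l 0 - l 1 * I);
      2 * c * (l 0 + l 1 * I), 2 * c ^ 2 - 1 - 2 * c * l 2] := by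
  have hc' : (c : ℂ) ^ 2 = 1 + (l 0 ^ 2 + l 1 ^ 2 + l 2 ^ 2) := by exact_mod_cast h
  rw [boost_eq hc h]
  ext i j
  fin_cases i <;> fin_cases j <;> simp [Matrix.mul_apply, Fin.sum_univ_two]
  · linear_combination -hc' - (l 1 : ℂ) ^ 2 * I_sq
  · ring
  · ring
  · linear_combination -hc' - (l 1 : ℂ) ^ 2 * I_sq

theorem boost_mul_self_injective {l m : Fin 3 → ℝ}
    (h : boost l * boost l = boost m * boost m) : l = m := by
  obtain ⟨c, hc, hcl, -⟩ := exists_boost_eq l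
  obtain ⟨d, hd, hdm, -⟩ := exists_boost_eq m
  rw [boost_mul_self hc.le hcl, boost_mul_self hd.le hdm] at h
  have h00 := congrArg Complex.re (congrFun (congrFun h 0) 0)
  have h11 := congrArg Complex.re (congrFun (congrFun h 1) 1)
  have h10 := congrFun (congrFun h 1) 0
  have hre := congrArg Complex.re h10
  have him := congrArg Complex.im h10
  simp [← Complex.ofReal_pow] at h00 h11 hre him
  have hcd : c = d := by
    rw [← sq_eq_sq₀ hc.le hd.le]
    linarith
  subst hcd
  have hl2 : l 2 = m 2 := mul_left_cancel₀ hc.ne' (by linarith)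
  funext i
  fin_cases i
  · simpa [hc.ne'] using hre
  · simpa [hc.ne'] using him
  · exact hl2

theorem exists_boost_mul_self {M : Matrix (Fin 2) (Fin 2) ℂ} (hM : M.det = 1) :
    ∃ l : Fin 3 → ℝ, boost l * boost l = Mᴴ * M := by
  obtain ⟨a, d, x, y, ha, hd, hA⟩ : ∃ a d x y : ℝ, 0 ≤ a ∧ 0 ≤ d ∧
      Mᴴ * M = !![(a : ℂ), x - y * I; x + y * I, d] := by
    refine ⟨normSq (M 0 0) + normSq (M 1 0), normSq (M 0 1) + normSq (M 1 1),
      ((Mᴴ * M) 1 0).re, ((Mᴴ * M) 1 0).im,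
      add_nonneg (normSq_nonneg _) (normSq_nonneg _),
      add_nonneg (normSq_nonneg _) (normSq_nonneg _), ?_⟩
    ext i j
    fin_cases i <;> fin_cases j <;> apply Complex.ext <;>
      simp [Matrix.mul_apply, Fin.sum_univ_two, normSq_apply] <;> ring
  have hdet : a * d - (x ^ 2 + y ^ 2) = 1 := by
    have h : (Mᴴ * M).det = 1 := by simp [hM]
    rw [hA, det_fin_two_of] at h
    have h' := congrArg Complex.re h
    simp at h'
    linarith
  obtain ⟨c, hc, hcs⟩ : ∃ c : ℝ, 0 < c ∧ 4 * c ^ 2 = a + d + 2 := by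
    have hpos : 0 < (a + d + 2) / 4 := by positivity
    refine ⟨√((a + d + 2) / 4), Real.sqrt_pos.2 hpos, ?_⟩
    rw [Real.sq_sqrt hpos.le]
    ring
  have hl : c ^ 2 = 1 + ((x / (2 * c)) ^ 2 + (y / (2 * c)) ^ 2 + ((a - d) / (4 * c)) ^ 2) := by
    field_simp
    linear_combination 4 * (4 * c ^ 2 + a + d - 2) * hcs + 16 * hdet
  refine ⟨![x / (2 * c), y / (2 * c), (a - d) / (4 * c)], ?_⟩
  have hc0 : (c : ℂ) ≠ 0 := by exact_mod_cast hc.ne'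
  have hcs' : 4 * (c : ℂ) ^ 2 = a + d + 2 := by exact_mod_cast hcs
  rw [boost_mul_self hc.le (by simpa using hl), hA]
  ext i j
  fin_cases i <;> fin_cases j <;> simp <;> field_simp
  · linear_combination 2 * hcs'
  · linear_combination 2 * hcs'

/-- Every `M ∈ SL(2,ℂ)` has a unique polar-type decomposition
`M = U (√(1+|λ|²) I₂ + λ₁τ₁ + λ₂τ₂ + λ₃τ₃)` with `U ∈ SU(2)` and `λ ∈ ℝ³`. -/
theorem polar_decomposition_SL2C (M : Matrix (Fin 2) (Fin 2) ℂ) (hM : M.det = 1) :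
    ∃! p : Matrix (Fin 2) (Fin 2) ℂ × (Fin 3 → ℝ),
      p.1 ∈ Matrix.unitaryGroup (Fin 2) ℂ ∧ p.1.det = 1 ∧
      M = p.1 *
        ((Real.sqrt (1 + (p.2 0 ^ 2 + p.2 1 ^ 2 + p.2 2 ^ 2)) : ℂ) •
            (1 : Matrix (Fin 2) (Fin 2) ℂ) +
          (p.2 0 : ℂ) • tau1 + (p.2 1 : ℂ) • tau2 + (p.2 2 : ℂ) • tau3) := by
  change ∃! p : Matrix (Fin 2) (Fin 2) ℂ × (Fin 3 → ℝ),
    p.1 ∈ Matrix.unitaryGroup (Fin 2) ℂ ∧ p.1.det = 1 ∧ M = p.1 * boost p.2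
  have hunit (l : Fin 3 → ℝ) : IsUnit (boost l).det := by simp [det_boost]
  obtain ⟨l, hl⟩ := exists_boost_mul_self hM
  refine ⟨(M * (boost l)⁻¹, l), ⟨?_, ?_, ?_⟩, ?_⟩
  · rw [mem_unitaryGroup_iff', star_eq_conjTranspose, conjTranspose_mul,
      conjTranspose_nonsing_inv, conjTranspose_boost, Matrix.mul_assoc,
      ← Matrix.mul_assoc Mᴴ, ← hl, mul_nonsing_inv_cancel_right _ _ (hunit l),
      nonsing_inv_mul _ (hunit l)]
  · simp [det_nonsing_inv, det_boost, hM]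
  · rw [nonsing_inv_mul_cancel_right _ _ (hunit l)]
  · rintro ⟨U, m⟩ ⟨hU, -, h⟩
    dsimp only at hU h
    rw [mem_unitaryGroup_iff', star_eq_conjTranspose] at hU
    have hm : boost m * boost m = Mᴴ * M := by
      rw [h, conjTranspose_mul, conjTranspose_boost, Matrix.mul_assoc, ← Matrix.mul_assoc Uᴴ,
        hU, Matrix.one_mul]
    obtain rfl := boost_mul_self_injective (hm.trans hl.symm)
    rw [h, mul_nonsing_inv_cancel_right _ _ (hunit m)]
end

section
/- The map (X,ξ) ↦ Z₀I₂ + i(Z₁τ₁ + Z₂τ₂ + Z₃τ₃), where Z = cosh(|ξ|)·X + i·(sinh(|ξ|)/|ξ|)·ξ (interpreted as Z = X when ξ = 0), is a bijection from TS³ = {(X,ξ) ∈ ℝ⁴×ℝ⁴ : |X| = 1, X·ξ = 0} onto SL(2,ℂ). -/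
open Matrix Complex

/-- The tangent bundle of the unit 3-sphere, `TS³ = {(X,ξ) : |X| = 1, X·ξ = 0}`,
as a subset of `ℝ⁴ × ℝ⁴`. -/
def TS3 : Set ((Fin 4 → ℝ) × (Fin 4 → ℝ)) :=
  {p | p.1 0 ^ 2 + p.1 1 ^ 2 + p.1 2 ^ 2 + p.1 3 ^ 2 = 1 ∧
       p.1 0 * p.2 0 + p.1 1 * p.2 1 + p.1 2 * p.2 2 + p.1 3 * p.2 3 = 0}

/-- The Candelas–de la Ossa identification map `(X,ξ) ↦ Z₀I₂ + i Z⃗·τ⃗`, where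
`Z = cosh|ξ| X + i (sinh|ξ|/|ξ|) ξ` (interpreted as `Z = X` when `ξ = 0`). -/
noncomputable def conifoldMap (p : (Fin 4 → ℝ) × (Fin 4 → ℝ)) :
    Matrix (Fin 2) (Fin 2) ℂ :=
  let r : ℝ := Real.sqrt (p.2 0 ^ 2 + p.2 1 ^ 2 + p.2 2 ^ 2 + p.2 3 ^ 2)
  let Z : Fin 4 → ℂ := fun i =>
    (Real.cosh r : ℂ) * (p.1 i : ℂ) +
      Complex.I * (((if r = 0 then 1 else Real.sinh r / r : ℝ) : ℂ) * (p.2 i : ℂ))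
  Z 0 • (1 : Matrix (Fin 2) (Fin 2) ℂ) +
    Complex.I • (Z 1 • tau1 + Z 2 • tau2 + Z 3 • tau3)

/-- The matrix `Z₀I₂ + i Z⃗·τ⃗` attached to a point `Z` of `ℂ⁴`. -/
noncomputable def pauliMatrix (Z : Fin 4 → ℂ) : Matrix (Fin 2) (Fin 2) ℂ :=
  Z 0 • (1 : Matrix (Fin 2) (Fin 2) ℂ) +
    Complex.I • (Z 1 • tau1 + Z 2 • tau2 + Z 3 • tau3)

/-- The Euclidean norm on `ℝ⁴`. -/
noncomputable def euclNorm (v : Fin 4 → ℝ) : ℝ :=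
  Real.sqrt (v 0 ^ 2 + v 1 ^ 2 + v 2 ^ 2 + v 3 ^ 2)

/-- The function `sinh r / r`, extended by `1` at `r = 0`. -/
noncomputable def sinhQuot (r : ℝ) : ℝ := if r = 0 then 1 else Real.sinh r / r

theorem pauliMatrix_eq (Z : Fin 4 → ℂ) :
    pauliMatrix Z = !![Z 0 + I * Z 3, I * Z 1 + Z 2; I * Z 1 - Z 2, Z 0 - I * Z 3] := by
  ext i j
  fin_cases i <;> fin_cases j <;>
    simp [pauliMatrix, tau1, tau2, tau3]
  · linear_combination (-Z 2) * I_sq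
  · linear_combination Z 2 * I_sq
  · ring

theorem det_pauliMatrix (Z : Fin 4 → ℂ) :
    (pauliMatrix Z).det = Z 0 ^ 2 + Z 1 ^ 2 + Z 2 ^ 2 + Z 3 ^ 2 := by
  rw [pauliMatrix_eq, det_fin_two_of]
  linear_combination (-Z 3 ^ 2 - Z 1 ^ 2) * I_sq

theorem pauliMatrix_injective : Function.Injective pauliMatrix := by
  intro Z W h
  simp only [pauliMatrix_eq] at h
  have h00 := congrFun (congrFun h 0) 0
  have h01 := congrFun (congrFun h 0) 1
  have h10 := congrFun (congrFun h 1) 0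
  have h11 := congrFun (congrFun h 1) 1
  simp at h00 h01 h10 h11
  ext i
  fin_cases i <;> simp only [Fin.zero_eta, Fin.mk_one, Fin.reduceFinMk]
  · linear_combination (h00 + h11) / 2
  · linear_combination (-I / 2) * (h01 + h10) + (Z 1 - W 1) * I_sq
  · linear_combination (h01 - h10) / 2
  · linear_combination (-I / 2) * (h00 - h11) + (Z 3 - W 3) * I_sq

theorem pauliMatrix_surjective : Function.Surjective pauliMatrix := by
  intro M
  refine ⟨![(M 0 0 + M 1 1) / 2, -I * (M 0 1 + M 1 0) / 2, (M 0 1 - M 1 0) / 2,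
    -I * (M 0 0 - M 1 1) / 2], ?_⟩
  rw [pauliMatrix_eq]
  ext i j
  fin_cases i <;> fin_cases j <;> simp
  · linear_combination (-(M 0 0 - M 1 1) / 2) * I_sq
  · linear_combination (-(M 0 1 + M 1 0) / 2) * I_sq
  · linear_combination (-(M 0 1 + M 1 0) / 2) * I_sq
  · linear_combination ((M 0 0 - M 1 1) / 2) * I_sq

theorem euclNorm_nonneg (v : Fin 4 → ℝ) : 0 ≤ euclNorm v := Real.sqrt_nonneg _

theorem euclNorm_sq (v : Fin 4 → ℝ) :
    euclNorm v ^ 2 = v 0 ^ 2 + v 1 ^ 2 + v 2 ^ 2 + v 3 ^ 2 :=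
  Real.sq_sqrt (by positivity)

theorem euclNorm_smul {c : ℝ} (hc : 0 ≤ c) (v : Fin 4 → ℝ) :
    euclNorm (c • v) = c * euclNorm v := by
  rw [← sq_eq_sq₀ (euclNorm_nonneg _) (mul_nonneg hc (euclNorm_nonneg _)), mul_pow,
    euclNorm_sq, euclNorm_sq]
  simp only [Pi.smul_apply, smul_eq_mul]
  ring

theorem sinhQuot_mul_self (r : ℝ) : sinhQuot r * r = Real.sinh r := by
  unfold sinhQuot
  split_ifs with h
  · simp [h]
  · field_simp

theorem sinhQuot_pos {r : ℝ} (hr : 0 ≤ r) : 0 < sinhQuot r := by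
  unfold sinhQuot
  split_ifs with h
  · exact one_pos
  · have : 0 < r := lt_of_le_of_ne hr (Ne.symm h)
    exact div_pos (Real.sinh_pos_iff.2 this) this

theorem conifoldMap_eq (p : (Fin 4 → ℝ) × (Fin 4 → ℝ)) :
    conifoldMap p = pauliMatrix fun i =>
      ⟨Real.cosh (euclNorm p.2) * p.1 i, sinhQuot (euclNorm p.2) * p.2 i⟩ := by
  have h : (fun i => (⟨Real.cosh (euclNorm p.2) * p.1 i,
      sinhQuot (euclNorm p.2) * p.2 i⟩ : ℂ)) = fun i =>
      (Real.cosh (euclNorm p.2) : ℂ) * (p.1 i : ℂ) +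
        I * ((sinhQuot (euclNorm p.2) : ℂ) * (p.2 i : ℂ)) := by
    funext i
    rw [Complex.mk_eq_add_mul_I]
    push_cast
    ring
  rw [h]
  rfl

theorem injOn_conifoldMap : Set.InjOn conifoldMap TS3 := by
  rintro ⟨X, v⟩ ⟨hX, -⟩ ⟨Y, w⟩ ⟨hY, -⟩ h
  rw [conifoldMap_eq, conifoldMap_eq] at h
  have hZ := congrFun (pauliMatrix_injective h)
  have hre (i : Fin 4) : Real.cosh (euclNorm v) * X i = Real.cosh (euclNorm w) * Y i :=
    congrArg Complex.re (hZ i)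
  have him (i : Fin 4) : sinhQuot (euclNorm v) * v i = sinhQuot (euclNorm w) * w i :=
    congrArg Complex.im (hZ i)
  have hcosh_sq : Real.cosh (euclNorm v) ^ 2 = Real.cosh (euclNorm w) ^ 2 := by
    have hsq (i : Fin 4) := congrArg (· ^ 2) (hre i)
    simp only [mul_pow] at hsq
    dsimp only at hX hY
    linear_combination hsq 0 + hsq 1 + hsq 2 + hsq 3 -
      Real.cosh (euclNorm v) ^ 2 * hX + Real.cosh (euclNorm w) ^ 2 * hY
  have hcosh := (sq_eq_sq₀ (Real.cosh_pos _).le (Real.cosh_pos _).le).1 hcosh_sq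
  have hr : euclNorm v = euclNorm w :=
    Real.cosh_strictMonoOn.injOn (euclNorm_nonneg v) (euclNorm_nonneg w) hcosh
  rw [hr] at hre him
  refine Prod.ext (funext fun i => ?_) (funext fun i => ?_)
  · exact mul_left_cancel₀ (Real.cosh_pos _).ne' (hre i)
  · exact mul_left_cancel₀ (sinhQuot_pos (euclNorm_nonneg w)).ne' (him i)

theorem det_conifoldMap {p : (Fin 4 → ℝ) × (Fin 4 → ℝ)} (hp : p ∈ TS3) :
    (conifoldMap p).det = 1 := by
  obtain ⟨hX, hv⟩ := hp
  have hs := sinhQuot_mul_self (euclNorm p.2)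
  have hn := euclNorm_sq p.2
  have hc := Real.cosh_sq (euclNorm p.2)
  rw [← hs] at hc
  rw [conifoldMap_eq, det_pauliMatrix]
  apply Complex.ext
  · simp [pow_two]
    linear_combination Real.cosh (euclNorm p.2) ^ 2 * hX + hc +
      sinhQuot (euclNorm p.2) ^ 2 * hn
  · simp [pow_two]
    linear_combination 2 * Real.cosh (euclNorm p.2) * sinhQuot (euclNorm p.2) * hv

theorem exists_conifoldMap_eq {M : Matrix (Fin 2) (Fin 2) ℂ} (hM : M.det = 1) :
    ∃ p ∈ TS3, conifoldMap p = M := by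
  obtain ⟨Z, rfl⟩ := pauliMatrix_surjective M
  rw [det_pauliMatrix] at hM
  have hre := congrArg Complex.re hM
  have him := congrArg Complex.im hM
  simp [pow_two] at hre him
  set b : Fin 4 → ℝ := fun i => (Z i).im with hb
  set r := Real.arsinh (euclNorm b)
  have hsinh : Real.sinh r = euclNorm b := Real.sinh_arsinh _
  have hr0 : 0 ≤ r := Real.arsinh_nonneg_iff.2 (euclNorm_nonneg b)
  have hs := sinhQuot_pos hr0
  have hc := Real.cosh_pos r
  have hnorm : euclNorm ((sinhQuot r)⁻¹ • b) = r := by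
    rw [euclNorm_smul (inv_nonneg.2 hs.le), ← hsinh, ← sinhQuot_mul_self,
      inv_mul_cancel_left₀ hs.ne']
  have hcosh : Real.cosh r ^ 2 =
      (Z 0).re ^ 2 + (Z 1).re ^ 2 + (Z 2).re ^ 2 + (Z 3).re ^ 2 := by
    rw [Real.cosh_sq, hsinh, euclNorm_sq]
    linear_combination -hre
  refine ⟨((Real.cosh r)⁻¹ • fun i => (Z i).re, (sinhQuot r)⁻¹ • b), ⟨?_, ?_⟩, ?_⟩
  · simp only [Pi.smul_apply, smul_eq_mul]
    field_simp
    exact hcosh.symm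
  · simp only [Pi.smul_apply, smul_eq_mul, hb]
    linear_combination (Real.cosh r)⁻¹ * (sinhQuot r)⁻¹ / 2 * him
  · rw [conifoldMap_eq]
    congr 1
    funext i
    simp only [hnorm, Pi.smul_apply, smul_eq_mul, mul_inv_cancel_left₀ hc.ne',
      mul_inv_cancel_left₀ hs.ne']
    rfl

/-- The map `(X,ξ) ↦ Z₀I₂ + i Z⃗·τ⃗` is a bijection from `TS³` onto `SL(2,ℂ)`. -/
theorem conifoldMap_bijective :
    Set.InjOn conifoldMap TS3 ∧
    conifoldMap '' TS3 = {M : Matrix (Fin 2) (Fin 2) ℂ | M.det = 1} := by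
  refine ⟨injOn_conifoldMap, Set.Subset.antisymm ?_ fun M hM => exists_conifoldMap_eq hM⟩
  rintro _ ⟨p, hp, rfl⟩
  exact det_conifoldMap hp
end

section
/- Let I ⊆ (0,∞) be a nonempty open interval and let A, Ā : I → ℝ be differentiable with A(λ) > 0 and Ā(λ) ≠ 0 for all λ ∈ I. Suppose that for all λ ∈ I: (1+2λ²)/4 + ((λ+λ³)/4)·(Ā′(λ)/Ā(λ)) = −2·[(1+2λ²)/4 + ((λ+λ³)/4)·(A′(λ)/A(λ))]. Then there exists a constant C ≠ 0 such that A(λ)²·Ā(λ) = C·λ⁻³·(1+λ²)^(−3/2) for all λ ∈ I. -/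
open Set

/-- If `A` and `Abar` have derivatives `a` and `b` at `l` and these satisfy the scalar-flatness
equation with denominators cleared, then `A² Ā λ³ (1+λ²)^{3/2}` has zero derivative at `l`. -/
theorem hasDerivAt_first_integral_zero {A Abar : ℝ → ℝ} {a b l : ℝ}
    (hA : HasDerivAt A a l) (hAbar : HasDerivAt Abar b l)
    (h : (l + l ^ 3) * (A l * b + 2 * a * Abar l) = -3 * (1 + 2 * l ^ 2) * (A l * Abar l)) :
    HasDerivAt (fun x => A x ^ 2 * Abar x * x ^ 3 * (1 + x ^ 2) ^ ((3 : ℝ) / 2)) 0 l := by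
  have hpos : 0 < 1 + l ^ 2 := by positivity
  have hs : (1 + l ^ 2) ^ ((3 : ℝ) / 2) = (1 + l ^ 2) * (1 + l ^ 2) ^ ((3 : ℝ) / 2 - 1) := by
    rw [Real.rpow_sub_one hpos.ne']
    field_simp
  have hq : HasDerivAt (fun x : ℝ => 1 + x ^ 2) (2 * l) l := by
    simpa using (hasDerivAt_pow 2 l).const_add 1
  have hr := hq.rpow_const (p := (3 : ℝ) / 2) (Or.inl hpos.ne')
  refine ((((hA.fun_pow 2).fun_mul hAbar).fun_mul (hasDerivAt_pow 3 l)).fun_mul hr).congr_deriv ?_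
  rw [hs]
  push_cast
  linear_combination A l * l ^ 2 * (1 + l ^ 2) ^ ((3 : ℝ) / 2 - 1) * h

/-- On any nonempty open interval `I ⊆ (0,∞)` on which `A > 0` and `Ā ≠ 0`, the
scalar-flatness ratio condition `B̄/Ā = -2B/A` integrates to
`A² Ā = C λ⁻³ (1+λ²)^{-3/2}` for some constant `C ≠ 0` (equation (25) of the paper). -/
theorem scalar_flat_first_integral (I : Set ℝ) (hIopen : IsOpen I)
    (hIne : I.Nonempty) (hIconn : IsPreconnected I) (hIsub : I ⊆ Set.Ioi 0)
    (A A' Abar Abar' : ℝ → ℝ)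
    (hA : ∀ l ∈ I, HasDerivAt A (A' l) l)
    (hAbar : ∀ l ∈ I, HasDerivAt Abar (Abar' l) l)
    (hApos : ∀ l ∈ I, 0 < A l)
    (hAbarne : ∀ l ∈ I, Abar l ≠ 0)
    (heq : ∀ l ∈ I,
      (1 + 2 * l ^ 2) / 4 + ((l + l ^ 3) / 4) * (Abar' l / Abar l) =
        -2 * ((1 + 2 * l ^ 2) / 4 + ((l + l ^ 3) / 4) * (A' l / A l))) :
    ∃ C : ℝ, C ≠ 0 ∧ ∀ l ∈ I,
      (A l) ^ 2 * Abar l = C * l ^ (-(3 : ℝ)) * (1 + l ^ 2) ^ (-(3 : ℝ) / 2) := by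
  have hderiv : ∀ l ∈ I, HasDerivAt
      (fun x => A x ^ 2 * Abar x * x ^ 3 * (1 + x ^ 2) ^ ((3 : ℝ) / 2)) 0 l := by
    intro l hl
    refine hasDerivAt_first_integral_zero (hA l hl) (hAbar l hl) ?_
    have h := heq l hl
    have hAl := (hApos l hl).ne'
    have hBl := hAbarne l hl
    field_simp at h
    linear_combination h
  obtain ⟨l₀, hl₀⟩ := hIne
  have hl₀pos : 0 < l₀ := hIsub hl₀
  refine ⟨A l₀ ^ 2 * Abar l₀ * l₀ ^ 3 * (1 + l₀ ^ 2) ^ ((3 : ℝ) / 2), ?_, fun l hl => ?_⟩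
  · have := hAbarne l₀ hl₀
    have := (hApos l₀ hl₀).ne'
    positivity
  · have hlpos : 0 < l := hIsub hl
    rw [← hIopen.is_const_of_deriv_eq_zero hIconn
      (fun x hx => (hderiv x hx).differentiableAt.differentiableWithinAt)
      (fun x hx => (hderiv x hx).deriv) hl hl₀]
    have hcube : l ^ (-(3 : ℝ)) = (l ^ 3)⁻¹ := by
      rw [Real.rpow_neg hlpos.le]
      norm_cast
    rw [hcube, neg_div, Real.rpow_neg (by positivity)]
    field_simp
end

section
/- Let A, Ā : [0,∞) → ℝ be continuous on [0,∞) and differentiable on (0,∞), with A(λ) > 0 for all λ ≥ 0. For λ > 0 define B(λ) = (1/4)[(1+2λ²)A(λ) + λ(1+λ²)A′(λ)] and B̄(λ) = (1/4)[(1+2λ²)Ā(λ) + λ(1+λ²)Ā′(λ)]. If 2Ā(λ)B(λ) + B̄(λ)A(λ) = 0 for all λ > 0, then Ā(λ) = 0 for all λ ≥ 0. -/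
open Set

/-- Analytic core of the paper's Theorem 2: if the metric component function `A`
and the Ricci component function `Ā` are continuous on `[0,∞)`, differentiable on
`(0,∞)`, `A > 0`, and the scalar-flatness condition `2ĀB + B̄A = 0` holds on
`(0,∞)` (where `B = (1/4)[(1+2λ²)A + λ(1+λ²)A′]` and `B̄` is built the same way
from `Ā`), then `Ā ≡ 0` on `[0,∞)`, i.e. the metric is Ricci flat. -/
theorem scalar_flat_implies_ricci_flat (A Abar A' Abar' : ℝ → ℝ)
    (hAc : ContinuousOn A (Set.Ici 0)) (hAbarc : ContinuousOn Abar (Set.Ici 0))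
    (hA : ∀ l > (0 : ℝ), HasDerivAt A (A' l) l)
    (hAbar : ∀ l > (0 : ℝ), HasDerivAt Abar (Abar' l) l)
    (hApos : ∀ l ≥ (0 : ℝ), 0 < A l)
    (h : ∀ l > (0 : ℝ),
      2 * Abar l * ((1 / 4) * ((1 + 2 * l ^ 2) * A l + l * (1 + l ^ 2) * A' l)) +
        ((1 / 4) * ((1 + 2 * l ^ 2) * Abar l + l * (1 + l ^ 2) * Abar' l)) * A l = 0) :
    ∀ l ≥ (0 : ℝ), Abar l = 0 := by
  set G : ℝ → ℝ := fun l => (l ^ 2 * (1 + l ^ 2)) ^ 3 * (A l ^ 2 * Abar l) ^ 2 with hG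
  have hGc : ContinuousOn G (Ici 0) := by fun_prop
  have hGd : ∀ l > (0 : ℝ), HasDerivAt G 0 l := by
    intro l hl
    have hp : HasDerivAt (fun x : ℝ => x ^ 2) (2 * l) l := by
      simpa using hasDerivAt_pow 2 l
    have hd := ((hp.mul (hp.const_add 1)).pow 3).mul ((((hA l hl).pow 2).mul (hAbar l hl)).pow 2)
    refine hd.congr_deriv ?_
    simp only [Pi.mul_apply, Pi.pow_apply]
    push_cast
    linear_combination
      8 * A l ^ 3 * Abar l * l ^ 5 * (1 + l ^ 2) ^ 2 * h l hl
  have hpos : ∀ l > (0 : ℝ), Abar l = 0 := by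
    intro l hl
    obtain ⟨c, hc, hslope⟩ := exists_hasDerivAt_eq_slope G (fun _ => 0) hl
      (hGc.mono Icc_subset_Ici_self) (fun x hx => hGd x hx.1)
    have hG0 : G 0 = 0 := by simp [hG]
    have hGl : G l = 0 := by
      rw [hG0, eq_div_iff (by linarith)] at hslope
      linarith
    have hAl := (hApos l hl.le).ne'
    have hq : (1 + l ^ 2 : ℝ) ≠ 0 := by positivity
    simpa [hG, hl.ne', hq, hAl] using hGl
  intro l hl
  have hclosed : EqOn Abar (fun _ => 0) (Ici 0) :=
    EqOn.of_subset_closure (s := Ioi 0) (fun x hx => hpos x hx) hAbarc continuousOn_const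
      Ioi_subset_Ici_self (closure_Ioi (0 : ℝ)).ge
  exact hclosed hl
end

section
/- The function β satisfies the Riccati equation λ(1+λ²)β′(λ) + 3λ(1+λ²)β(λ)² + (9λ²+4)β(λ) + 4λ = 0 for all λ > 0. -/
/-- The logarithmic derivative `β = A′/A` of the deformed conifold metric
component function, equation (13) of the paper. -/
noncomputable def betaFn (l : ℝ) : ℝ :=
  -(((4 * l ^ 5 + 4 * l ^ 3 + 3 * l) * Real.sqrt (1 + l ^ 2) -
        (6 * l ^ 2 + 3) * Real.arsinh l) /
    (3 * l * ((2 * l ^ 5 + 3 * l ^ 3 + l) * Real.sqrt (1 + l ^ 2) -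
        (1 + l ^ 2) * Real.arsinh l)))

/-- The numerator of `-betaFn`. -/
noncomputable def betaNum (l : ℝ) : ℝ :=
  (4 * l ^ 5 + 4 * l ^ 3 + 3 * l) * Real.sqrt (1 + l ^ 2) - (6 * l ^ 2 + 3) * Real.arsinh l

/-- The transcendental factor of the denominator of `betaFn`. -/
noncomputable def betaDen (l : ℝ) : ℝ :=
  (2 * l ^ 3 + l) * Real.sqrt (1 + l ^ 2) - Real.arsinh l

theorem betaFn_eq_neg_div (l : ℝ) :
    betaFn l = -(betaNum l / (3 * l * (1 + l ^ 2) * betaDen l)) := by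
  unfold betaFn betaNum betaDen
  congr 2
  ring

theorem betaDen_pos {l : ℝ} (hl : 0 < l) : 0 < betaDen l := by
  have ha : Real.arsinh l < l := by
    rw [← Real.sinh_lt_sinh, Real.sinh_arsinh]
    exact Real.self_lt_sinh_iff.2 hl
  have hs : 1 ≤ Real.sqrt (1 + l ^ 2) := Real.one_le_sqrt.2 (by nlinarith)
  have h3 : 0 < l ^ 3 := by positivity
  unfold betaDen
  nlinarith [mul_le_mul_of_nonneg_left hs (by positivity : 0 ≤ 2 * l ^ 3 + l)]

theorem hasDerivAt_sqrt_one_add_sq (l : ℝ) :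
    HasDerivAt (fun x : ℝ => Real.sqrt (1 + x ^ 2)) (l / Real.sqrt (1 + l ^ 2)) l := by
  have h1 : (1 + l ^ 2 : ℝ) ≠ 0 := by positivity
  refine (((hasDerivAt_pow 2 l).const_add 1).sqrt h1).congr_deriv ?_
  field_simp
  simp

theorem hasDerivAt_betaDen (l : ℝ) :
    HasDerivAt betaDen (8 * l ^ 2 * Real.sqrt (1 + l ^ 2)) l := by
  have hp : HasDerivAt (fun x : ℝ => 2 * x ^ 3 + x) (6 * l ^ 2 + 1) l := by
    refine (((hasDerivAt_pow 3 l).const_mul 2).add (hasDerivAt_id l)).congr_deriv ?_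
    norm_num
    ring
  have h := (hp.mul (hasDerivAt_sqrt_one_add_sq l)).sub (Real.hasDerivAt_arsinh l)
  refine h.congr_deriv ?_
  have hs : 0 < Real.sqrt (1 + l ^ 2) := Real.sqrt_pos.2 (by positivity)
  have hsq : Real.sqrt (1 + l ^ 2) ^ 2 = 1 + l ^ 2 := Real.sq_sqrt (by positivity)
  field_simp
  linear_combination (1 - 2 * l ^ 2) * hsq

theorem hasDerivAt_betaNum (l : ℝ) : HasDerivAt betaNum (12 * l * betaDen l) l := by
  have hp : HasDerivAt (fun x : ℝ => 4 * x ^ 5 + 4 * x ^ 3 + 3 * x)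
      (20 * l ^ 4 + 12 * l ^ 2 + 3) l := by
    refine ((((hasDerivAt_pow 5 l).const_mul 4).add ((hasDerivAt_pow 3 l).const_mul 4)).add
      ((hasDerivAt_id l).const_mul 3)).congr_deriv ?_
    norm_num
    ring
  have hq : HasDerivAt (fun x : ℝ => 6 * x ^ 2 + 3) (12 * l) l := by
    refine (((hasDerivAt_pow 2 l).const_mul 6).add_const 3).congr_deriv ?_
    norm_num
    ring
  have h := (hp.mul (hasDerivAt_sqrt_one_add_sq l)).sub (hq.mul (Real.hasDerivAt_arsinh l))
  refine h.congr_deriv ?_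
  have hs : 0 < Real.sqrt (1 + l ^ 2) := Real.sqrt_pos.2 (by positivity)
  have hsq : Real.sqrt (1 + l ^ 2) ^ 2 = 1 + l ^ 2 := Real.sq_sqrt (by positivity)
  unfold betaDen
  field_simp
  linear_combination (3 - 4 * l ^ 4) * hsq

/-- The linear relation between the numerator and the denominator of `betaFn`
behind the Riccati equation. -/
theorem betaNum_eq (l : ℝ) :
    betaNum l = 3 * (2 * l ^ 2 + 1) * betaDen l -
      8 * l ^ 3 * (1 + l ^ 2) * Real.sqrt (1 + l ^ 2) := by
  unfold betaNum betaDen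
  ring

/-- `β` satisfies the Riccati equation
`λ(1+λ²)β′ + 3λ(1+λ²)β² + (9λ²+4)β + 4λ = 0` for all `λ > 0`
(equivalent to the Ricci-flatness condition for the deformed conifold). -/
theorem betaFn_riccati (l : ℝ) (hl : 0 < l) :
    l * (1 + l ^ 2) * deriv betaFn l + 3 * l * (1 + l ^ 2) * (betaFn l) ^ 2 +
      (9 * l ^ 2 + 4) * betaFn l + 4 * l = 0 := by
  have hE := (betaDen_pos hl).ne'
  have hp : HasDerivAt (fun x : ℝ => 3 * x * (1 + x ^ 2)) (3 + 9 * l ^ 2) l := by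
    refine (((hasDerivAt_id l).const_mul 3).mul
      ((hasDerivAt_pow 2 l).const_add 1)).congr_deriv ?_
    norm_num
    ring
  have hd := ((hasDerivAt_betaNum l).div (hp.mul (hasDerivAt_betaDen l))
    (mul_ne_zero (by positivity) hE)).neg
  have hfun : betaFn = -(betaNum / ((fun x : ℝ => 3 * x * (1 + x ^ 2)) * betaDen)) :=
    funext betaFn_eq_neg_div
  rw [← hfun] at hd
  rw [hd.deriv, betaFn_eq_neg_div]
  simp only [Pi.mul_apply]
  field_simp
  linear_combination 3 * betaNum l * betaNum_eq l
end

section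
/- β extends continuously to λ = 0 with value 0; more precisely, lim_{λ→0⁺} β(λ)/λ = −4/5 (in particular lim_{λ→0⁺} β(λ) = 0, so the deformed conifold component function A = exp(∫₀^λ β) satisfies A′(0) = 0, the regularity condition on the exceptional orbit). -/
open Filter Topology

/-- The fifth-order Taylor coefficient of `arsinh l / √(1 + l²)` at `0` is `8 / 15`. -/
theorem tendsto_arsinh_remainder_div_pow :
    Tendsto (fun l : ℝ => (Real.arsinh l - Real.sqrt (1 + l ^ 2) * (l - 2 / 3 * l ^ 3)) / l ^ 5)
      (𝓝[>] (0 : ℝ)) (𝓝 (8 / 15)) := by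
  have hsqrt : Continuous fun l : ℝ => Real.sqrt (1 + l ^ 2) := by fun_prop
  have hderiv : ∀ l : ℝ, HasDerivAt
      (fun l : ℝ => Real.arsinh l - Real.sqrt (1 + l ^ 2) * (l - 2 / 3 * l ^ 3))
      (8 / 3 * l ^ 4 / Real.sqrt (1 + l ^ 2)) l := by
    intro l
    have hpos : 0 < 1 + l ^ 2 := by positivity
    have hs : Real.sqrt (1 + l ^ 2) ≠ 0 := (Real.sqrt_pos.2 hpos).ne'
    have hsq : Real.sqrt (1 + l ^ 2) ^ 2 = 1 + l ^ 2 := Real.sq_sqrt hpos.le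
    have hroot := (((hasDerivAt_id l).pow 2).const_add 1).sqrt hpos.ne'
    have hpoly := (hasDerivAt_id l).sub (((hasDerivAt_id l).pow 3).const_mul (2 / 3))
    refine ((Real.hasDerivAt_arsinh l).sub (hroot.mul hpoly)).congr_deriv ?_
    simp only [id, Pi.pow_apply, Pi.sub_apply]
    field_simp
    rw [hsq]
    norm_num
    ring
  refine HasDerivAt.lhopital_zero_nhdsGT (Eventually.of_forall hderiv)
    (Eventually.of_forall fun l => hasDerivAt_pow 5 l) ?_ ?_ ?_ ?_
  · filter_upwards [self_mem_nhdsWithin] with l hl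
    have : (0 : ℝ) < l := hl
    positivity
  · refine Tendsto.mono_left ?_ nhdsWithin_le_nhds
    simpa using (hderiv 0).continuousAt.tendsto
  · refine Tendsto.mono_left ?_ nhdsWithin_le_nhds
    simpa using (continuous_pow (M := ℝ) 5).tendsto 0
  · have h : Tendsto (fun l : ℝ => 8 / 15 / Real.sqrt (1 + l ^ 2)) (𝓝[>] 0) (𝓝 (8 / 15)) := by
      refine Tendsto.mono_left ?_ nhdsWithin_le_nhds
      simpa [Pi.div_def] using
        (tendsto_const_nhds (x := (8 / 15 : ℝ))).div (hsqrt.tendsto 0) (by simp)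
    refine h.congr' ?_
    filter_upwards [self_mem_nhdsWithin] with l hl
    have hl : (0 : ℝ) < l := hl
    have hs : Real.sqrt (1 + l ^ 2) ≠ 0 := (Real.sqrt_pos.2 (by positivity)).ne'
    norm_num
    field_simp
    norm_num

/-- `β` extends continuously to `λ = 0` with value `0`; more precisely
`lim_{λ→0⁺} β(λ)/λ = -4/5` (in particular `lim_{λ→0⁺} β(λ) = 0`). -/
theorem betaFn_limit_at_zero :
    Tendsto (fun l => betaFn l / l) (𝓝[>] (0 : ℝ)) (𝓝 (-4 / 5)) ∧
    Tendsto betaFn (𝓝[>] (0 : ℝ)) (𝓝 0) := by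
  have hid : Tendsto (fun l : ℝ => l) (𝓝[>] 0) (𝓝 0) := nhdsWithin_le_nhds
  have hmain : Tendsto (fun l => betaFn l / l) (𝓝[>] (0 : ℝ)) (𝓝 (-4 / 5)) := by
    have hq := tendsto_arsinh_remainder_div_pow
    set q : ℝ → ℝ := fun l =>
      (Real.arsinh l - Real.sqrt (1 + l ^ 2) * (l - 2 / 3 * l ^ 3)) / l ^ 5 with hqdef
    have hs : Tendsto (fun l : ℝ => Real.sqrt (1 + l ^ 2)) (𝓝[>] 0) (𝓝 1) := by
      simpa using ((hid.pow 2).const_add 1).sqrt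
    have hnum : Tendsto (fun l => 8 * Real.sqrt (1 + l ^ 2) - (6 * l ^ 2 + 3) * q l)
        (𝓝[>] 0) (𝓝 (8 * 1 - (6 * 0 ^ 2 + 3) * (8 / 15))) :=
      (hs.const_mul 8).sub ((((hid.pow 2).const_mul 6).add_const 3).mul hq)
    have hden : Tendsto
        (fun l => 3 * ((1 + l ^ 2) * (8 / 3 * Real.sqrt (1 + l ^ 2) - l ^ 2 * q l)))
        (𝓝[>] 0) (𝓝 (3 * ((1 + 0 ^ 2) * (8 / 3 * 1 - 0 ^ 2 * (8 / 15))))) :=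
      ((((hid.pow 2).const_add 1).mul
        ((hs.const_mul (8 / 3)).sub ((hid.pow 2).mul hq))).const_mul 3)
    have hlim := (hnum.div hden (by norm_num)).neg
    rw [show -((8 * 1 - (6 * 0 ^ 2 + 3) * (8 / 15)) /
      (3 * ((1 + 0 ^ 2) * (8 / 3 * 1 - 0 ^ 2 * (8 / 15))))) = (-4 / 5 : ℝ) by norm_num] at hlim
    refine hlim.congr' ?_
    filter_upwards [self_mem_nhdsWithin] with l hl
    have hl0 : l ≠ 0 := ne_of_gt hl
    have harsinh : Real.arsinh l =
        l ^ 5 * q l + Real.sqrt (1 + l ^ 2) * (l - 2 / 3 * l ^ 3) := by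
      simp only [hqdef]
      field_simp
      ring
    rw [betaFn, harsinh, neg_div, div_div, Pi.div_apply, neg_inj,
      ← mul_div_mul_left _ _ (pow_ne_zero 5 hl0)]
    congr 1 <;> ring
  refine ⟨hmain, ?_⟩
  have hprod := hmain.mul hid
  rw [mul_zero] at hprod
  refine hprod.congr' ?_
  filter_upwards [self_mem_nhdsWithin] with l hl
  exact div_mul_cancel₀ _ (ne_of_gt hl)
end

section
/- lim_{λ→∞} λ·β(λ) = −2/3. -/
open Filter Topology

theorem Real.arsinh_le_self {x : ℝ} (hx : 0 ≤ x) : Real.arsinh x ≤ x := by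
  have h := Real.self_le_sinh_iff.2 (Real.arsinh_nonneg_iff.2 hx)
  rwa [Real.sinh_arsinh] at h

theorem Real.arsinh_div_sqrt_mem_Icc {x : ℝ} (hx : 0 ≤ x) :
    Real.arsinh x / √(1 + x ^ 2) ∈ Set.Icc (0 : ℝ) 1 := by
  refine ⟨div_nonneg (Real.arsinh_nonneg_iff.2 hx) (Real.sqrt_nonneg _), ?_⟩
  refine div_le_one_of_le₀ ((Real.arsinh_le_self hx).trans ?_) (Real.sqrt_nonneg _)
  exact Real.le_sqrt_of_sq_le (by linarith)

theorem tendsto_inv_mul_arsinh_div_sqrt :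
    Tendsto (fun x : ℝ => x⁻¹ * (Real.arsinh x / √(1 + x ^ 2))) atTop (𝓝 0) := by
  refine squeeze_zero' ?_ ?_ tendsto_inv_atTop_zero
  all_goals
    filter_upwards [eventually_gt_atTop 0] with x hx
    obtain ⟨h0, h1⟩ := Real.arsinh_div_sqrt_mem_Icc hx.le
  · exact mul_nonneg (inv_nonneg.2 hx.le) h0
  · exact mul_le_of_le_one_right (inv_nonneg.2 hx.le) h1

/-- `l * betaFn l` as a rational function of `l⁻¹` and `l⁻¹ * (arsinh l / √(1 + l ^ 2))`. -/
theorem mul_betaFn_eq {l : ℝ} (hl : 0 < l) :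
    l * betaFn l =
      -((4 + 4 * l⁻¹ ^ 2 + 3 * l⁻¹ ^ 4 -
            (6 * l⁻¹ ^ 2 + 3 * l⁻¹ ^ 4) * (l⁻¹ * (Real.arsinh l / √(1 + l ^ 2)))) /
        (3 * (2 + 3 * l⁻¹ ^ 2 + l⁻¹ ^ 4 -
            (l⁻¹ ^ 4 + l⁻¹ ^ 2) * (l⁻¹ * (Real.arsinh l / √(1 + l ^ 2)))))) := by
  have hs : 0 < √(1 + l ^ 2) := Real.sqrt_pos.2 (by positivity)
  unfold betaFn
  generalize √(1 + l ^ 2) = s at *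
  generalize Real.arsinh l = a
  have hc : l ^ 5 * s ≠ 0 := by positivity
  rw [mul_neg, ← mul_div_assoc, mul_assoc 3 l, mul_left_comm 3 l, mul_div_mul_left _ _ hl.ne',
    ← mul_div_mul_left _ (3 * (2 + _ + _ - _)) hc]
  congr 2 <;> field_simp

/-- `lim_{λ→∞} λ β(λ) = -2/3`: the deformed conifold component function
`A = exp(∫₀^λ β)` decays like `λ^{-2/3}`. -/
theorem betaFn_limit_at_infinity :
    Tendsto (fun l => l * betaFn l) atTop (𝓝 (-2 / 3)) := by
  have hF : ContinuousAt (fun p : ℝ × ℝ =>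
      -((4 + 4 * p.1 ^ 2 + 3 * p.1 ^ 4 - (6 * p.1 ^ 2 + 3 * p.1 ^ 4) * p.2) /
        (3 * (2 + 3 * p.1 ^ 2 + p.1 ^ 4 - (p.1 ^ 4 + p.1 ^ 2) * p.2)))) (0, 0) := by
    refine (ContinuousAt.div ?_ ?_ ?_).neg
    · fun_prop
    · fun_prop
    · norm_num
  have h := hF.tendsto.comp
    (tendsto_inv_atTop_zero.prodMk_nhds tendsto_inv_mul_arsinh_div_sqrt)
  norm_num at h
  norm_num
  refine h.congr' ?_
  filter_upwards [eventually_gt_atTop 0] with l hl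
  simp only [mul_betaFn_eq hl, Function.comp_apply]
end

section
/- There exists λ₀ > 0 such that for all λ ≥ λ₀: exp(∫₀^λ β(μ) dμ) > λ^(−5/6). (That is, the deformed conifold component function A(λ) = exp(∫₀^λ β) satisfies the elementary estimate A(λ) > λ^(−5/6) for all sufficiently large λ.) -/
open Filter Topology intervalIntegral

/-- On `[1, ∞)` the function `β` is bounded below by `-(3/4) / l`. -/
lemma neg_three_quarters_mul_inv_le_betaFn {l : ℝ} (hl : 1 ≤ l) :
    -(3 / 4) * l⁻¹ ≤ betaFn l := by
  have hl0 : 0 < l := by linarith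
  have hs : 1 ≤ Real.sqrt (1 + l ^ 2) := Real.one_le_sqrt.2 (by nlinarith)
  have ha : 0 ≤ Real.arsinh l := Real.arsinh_nonneg_iff.2 hl0.le
  have ha' : Real.arsinh l ≤ l := by
    simpa using Real.self_le_sinh_iff.2 ha
  unfold betaFn
  generalize Real.sqrt (1 + l ^ 2) = s at *
  generalize Real.arsinh l = a at *
  have hD : 0 < (2 * l ^ 5 + 3 * l ^ 3 + l) * s - (1 + l ^ 2) * a := by
    have h1 : 2 * l ^ 5 + 3 * l ^ 3 + l ≤ (2 * l ^ 5 + 3 * l ^ 3 + l) * s :=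
      le_mul_of_one_le_right (by positivity) hs
    have h2 : (1 + l ^ 2) * a ≤ (1 + l ^ 2) * l :=
      mul_le_mul_of_nonneg_left ha' (by positivity)
    have h3 : 0 < 2 * l ^ 5 + 2 * l ^ 3 := by positivity
    nlinarith
  have hkey : 0 ≤ (2 * l ^ 5 + 11 * l ^ 3 - 3 * l) * s + (15 * l ^ 2 + 3) * a := by
    have h1 : l ≤ l ^ 3 := le_self_pow₀ hl (by norm_num)
    have h2 : 0 ≤ 2 * l ^ 5 + 11 * l ^ 3 - 3 * l := by
      have : 0 < l ^ 5 := by positivity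
      linarith
    positivity
  rw [neg_mul, neg_le_neg_iff, ← div_eq_mul_inv, div_div,
    div_le_div_iff₀ (by positivity) (by positivity)]
  nlinarith [mul_nonneg hl0.le hkey]

/-- The deformed conifold component function `A(λ) = exp(∫₀^λ β)` satisfies the
elementary estimate `A(λ) > λ^{-5/6}` for all sufficiently large `λ`. -/
theorem conifold_A_lower_bound :
    ∃ l₀ : ℝ, 0 < l₀ ∧ ∀ l ≥ l₀,
      Real.exp (∫ m in (0 : ℝ)..l, betaFn m) > l ^ (-(5 : ℝ) / 6) := by
  set C := ∫ m in (0 : ℝ)..1, betaFn m with hC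
  refine ⟨Real.exp (12 * |C| + 1), Real.exp_pos _, fun l hl => ?_⟩
  have hl1 : 1 ≤ l := (Real.one_le_exp (by positivity)).trans hl
  have hl0 : 0 < l := by linarith
  have hlog : 12 * |C| + 1 ≤ Real.log l := (Real.le_log_iff_exp_le hl0).2 hl
  have hCabs := neg_abs_le C
  have hCnonneg := abs_nonneg C
  rw [gt_iff_lt, Real.rpow_def_of_pos hl0, Real.exp_lt_exp]
  by_cases hint : IntervalIntegrable betaFn MeasureTheory.volume 0 l
  · have h01 : IntervalIntegrable betaFn MeasureTheory.volume 0 1 :=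
      hint.mono_set (by
        rw [Set.uIcc_of_le zero_le_one, Set.uIcc_of_le hl0.le]
        exact Set.Icc_subset_Icc_right hl1)
    have h1l : IntervalIntegrable betaFn MeasureTheory.volume 1 l :=
      hint.mono_set (by
        rw [Set.uIcc_of_le hl1, Set.uIcc_of_le hl0.le]
        exact Set.Icc_subset_Icc_left zero_le_one)
    have hinv : IntervalIntegrable (fun m : ℝ => -(3 / 4) * m⁻¹) MeasureTheory.volume 1 l :=
      (intervalIntegrable_inv_iff.2 (Or.inr (by
        rw [Set.uIcc_of_le hl1]
        exact fun h => absurd h.1 (by norm_num)))).const_mul _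
    have hmono : ∫ m in (1 : ℝ)..l, -(3 / 4) * m⁻¹ ≤ ∫ m in (1 : ℝ)..l, betaFn m :=
      integral_mono_on hl1 hinv h1l fun m hm => neg_three_quarters_mul_inv_le_betaFn hm.1
    rw [integral_const_mul, integral_inv_of_pos one_pos hl0, div_one] at hmono
    rw [← integral_add_adjacent_intervals h01 h1l]
    linarith
  · rw [integral_undef hint]
    linarith
end

section
/- For all λ > 0: (4λ⁵+4λ³+3λ)√(1+λ²) − (6λ²+3)·arsinh λ > 0 and (2λ⁵+3λ³+λ)√(1+λ²) − (1+λ²)·arsinh λ > 0. (Hence β(λ) is well defined and strictly negative for all λ > 0.) -/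
theorem arsinh_lt_self {x : ℝ} (hx : 0 < x) : Real.arsinh x < x := by
  have h := Real.self_lt_sinh_iff.mpr (Real.arsinh_pos_iff.mpr hx)
  rwa [Real.sinh_arsinh] at h

theorem hasDerivAt_mul_sqrt_div_sub_arsinh (x : ℝ) :
    HasDerivAt
      (fun y : ℝ => (4 * y ^ 5 + 4 * y ^ 3 + 3 * y) * Real.sqrt (1 + y ^ 2) / (6 * y ^ 2 + 3) -
        Real.arsinh y)
      (96 * x ^ 4 * (1 + x ^ 2) ^ 2 / (Real.sqrt (1 + x ^ 2) * (6 * x ^ 2 + 3) ^ 2)) x := by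
  have hpos : 0 < 1 + x ^ 2 := by positivity
  have hq : 6 * x ^ 2 + 3 ≠ 0 := by positivity
  have hs : Real.sqrt (1 + x ^ 2) ≠ 0 := (Real.sqrt_pos.mpr hpos).ne'
  have hss : Real.sqrt (1 + x ^ 2) ^ 2 = 1 + x ^ 2 := Real.sq_sqrt hpos.le
  have hP : HasDerivAt (fun y : ℝ => 4 * y ^ 5 + 4 * y ^ 3 + 3 * y)
      (20 * x ^ 4 + 12 * x ^ 2 + 3) x := by
    refine HasDerivAt.congr_deriv ((((hasDerivAt_pow 5 x).const_mul 4).add ((hasDerivAt_pow 3 x).const_mul 4)).add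
      ((hasDerivAt_id x).const_mul 3)) ?_
    norm_num
    ring
  have hQ : HasDerivAt (fun y : ℝ => 6 * y ^ 2 + 3) (12 * x) x := by
    refine HasDerivAt.congr_deriv (((hasDerivAt_pow 2 x).const_mul 6).add_const 3) ?_
    norm_num
    ring
  have hS : HasDerivAt (fun y : ℝ => Real.sqrt (1 + y ^ 2)) (x / Real.sqrt (1 + x ^ 2)) x := by
    refine HasDerivAt.congr_deriv (((hasDerivAt_pow 2 x).const_add 1).sqrt hpos.ne') ?_
    field_simp
    norm_num
  refine HasDerivAt.congr_deriv (((hP.mul hS).div hQ hq).sub (Real.hasDerivAt_arsinh x)) ?_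
  simp only [Pi.mul_apply]
  field_simp
  rw [hss]
  ring

theorem arsinh_lt_mul_sqrt_div {x : ℝ} (hx : 0 < x) :
    Real.arsinh x <
      (4 * x ^ 5 + 4 * x ^ 3 + 3 * x) * Real.sqrt (1 + x ^ 2) / (6 * x ^ 2 + 3) := by
  have hmono := strictMonoOn_of_hasDerivWithinAt_pos (convex_Ici (0 : ℝ))
    (fun y _ => (hasDerivAt_mul_sqrt_div_sub_arsinh y).continuousAt.continuousWithinAt)
    (fun y _ => (hasDerivAt_mul_sqrt_div_sub_arsinh y).hasDerivWithinAt)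
    (fun y hy => by
      rw [interior_Ici, Set.mem_Ioi] at hy
      positivity)
  have h := hmono Set.self_mem_Ici hx.le hx
  simpa using h

/-- For all `λ > 0` the numerator and denominator of `-β` are strictly positive;
hence `β(λ)` is well defined and strictly negative for all `λ > 0`. -/
theorem betaFn_neg (l : ℝ) (hl : 0 < l) :
    0 < (4 * l ^ 5 + 4 * l ^ 3 + 3 * l) * Real.sqrt (1 + l ^ 2) -
        (6 * l ^ 2 + 3) * Real.arsinh l ∧
    0 < (2 * l ^ 5 + 3 * l ^ 3 + l) * Real.sqrt (1 + l ^ 2) -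
        (1 + l ^ 2) * Real.arsinh l ∧
    betaFn l < 0 := by
  have hnum : 0 < (4 * l ^ 5 + 4 * l ^ 3 + 3 * l) * Real.sqrt (1 + l ^ 2) -
      (6 * l ^ 2 + 3) * Real.arsinh l := by
    have h := arsinh_lt_mul_sqrt_div hl
    rw [lt_div_iff₀ (by positivity)] at h
    linarith
  have hden : 0 < (2 * l ^ 5 + 3 * l ^ 3 + l) * Real.sqrt (1 + l ^ 2) -
      (1 + l ^ 2) * Real.arsinh l := by
    have hs : 1 ≤ Real.sqrt (1 + l ^ 2) := Real.one_le_sqrt.mpr (by nlinarith)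
    have h₁ : (1 + l ^ 2) * Real.arsinh l < (1 + l ^ 2) * l :=
      mul_lt_mul_of_pos_left (arsinh_lt_self hl) (by positivity)
    have h₂ := le_mul_of_one_le_right
      (show 0 ≤ 2 * l ^ 5 + 3 * l ^ 3 + l by positivity) hs
    have h₃ : 0 < 2 * l ^ 5 + 2 * l ^ 3 := by positivity
    linarith
  exact ⟨hnum, hden, neg_neg_of_pos (div_pos hnum (mul_pos (by positivity) hden))⟩
end

section
/- Fix λ > 0 and let D = √(1+λ²)·I₂ + λτ₃ = diag(√(1+λ²)+λ, √(1+λ²)−λ). For L, R ∈ SU(2), there exists ε ∈ {1,−1} with L·D·R = ε·D if and only if R is a diagonal matrix and L = ε·R⁻¹ for some ε ∈ {1,−1}. (Hence the isotropy group of the point [D] of PL(2,ℂ) under the action ([L],[R])·[M] = [LMR] of PU(2)×PU(2) is isomorphic to SO(2).) -/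
open Matrix Complex

/-- A matrix commuting with a diagonal matrix with distinct entries is diagonal. -/
theorem isDiag_of_commute_diagonal {n K : Type*} [Fintype n] [DecidableEq n] [Field K]
    {d : n → K} (hd : Function.Injective d) {R : Matrix n n K}
    (h : Commute (Matrix.diagonal d) R) : R.IsDiag := by
  intro i j hij
  have hentry := congrFun (congrFun h.eq i) j
  rw [Matrix.diagonal_mul, Matrix.mul_diagonal] at hentry
  have hzero : (d i - d j) * R i j = 0 := by linear_combination hentry
  exact (mul_eq_zero.mp hzero).resolve_left (sub_ne_zero.mpr (hd.ne hij))

/-- If `L D R = ε D` with `L`, `R` unitary, `D` Hermitian and `ε` real with `ε ^ 2 = 1`,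
then `D ^ 2` commutes with `R`. -/
theorem commute_sq_of_unitary_mul_mul_eq {n : Type*} [Fintype n] [DecidableEq n]
    {L R D : Matrix n n ℂ} (hL : L ∈ Matrix.unitaryGroup n ℂ)
    (hR : R ∈ Matrix.unitaryGroup n ℂ) (hD : D.IsHermitian) {ε : ℂ} (hε : ε = 1 ∨ ε = -1)
    (h : L * D * R = ε • D) : Commute (D * D) R := by
  have hLL : Lᴴ * L = 1 := Matrix.mem_unitaryGroup_iff'.mp hL
  have hRR : R * Rᴴ = 1 := Matrix.mem_unitaryGroup_iff.mp hR
  have hsq : (L * D * R)ᴴ * (L * D * R) = D * D := by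
    rw [h, Matrix.conjTranspose_smul, hD.eq]
    rcases hε with rfl | rfl <;> simp
  have hconj : Rᴴ * (D * D) * R = D * D := by
    rw [Matrix.conjTranspose_mul, Matrix.conjTranspose_mul, hD.eq] at hsq
    calc Rᴴ * (D * D) * R = Rᴴ * D * 1 * D * R := by simp only [Matrix.mul_one, Matrix.mul_assoc]
      _ = Rᴴ * (D * Lᴴ) * (L * D * R) := by rw [← hLL]; simp only [Matrix.mul_assoc]
      _ = D * D := hsq
  calc D * D * R = R * Rᴴ * (D * D * R) := by rw [hRR, Matrix.one_mul]
    _ = R * (Rᴴ * (D * D) * R) := by simp only [Matrix.mul_assoc]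
    _ = R * (D * D) := by rw [hconj]

/-- The matrix `a I₂ + b τ₃` as a diagonal matrix. -/
theorem smul_one_add_smul_tau3 (a b : ℂ) :
    a • (1 : Matrix (Fin 2) (Fin 2) ℂ) + b • tau3 = Matrix.diagonal ![a + b, a - b] := by
  ext i j
  fin_cases i <;> fin_cases j <;> simp [tau3, sub_eq_add_neg]

/-- Isotropy of a generic orbit point: for `λ > 0`, `D = √(1+λ²) I₂ + λ τ₃` and
`L, R ∈ SU(2)`, one has `L D R = ± D` iff `R` is diagonal and `L = ± R⁻¹`.
Hence the isotropy group of `[D] ∈ PL(2,ℂ)` under `([L],[R])·[M] = [LMR]`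
is isomorphic to `SO(2)`. -/
theorem isotropy_generic_orbit (l : ℝ) (hl : 0 < l)
    (L R : Matrix (Fin 2) (Fin 2) ℂ)
    (hL : L ∈ Matrix.unitaryGroup (Fin 2) ℂ) (hLdet : L.det = 1)
    (hR : R ∈ Matrix.unitaryGroup (Fin 2) ℂ) (hRdet : R.det = 1) :
    (∃ ε : ℂ, (ε = 1 ∨ ε = -1) ∧
        L * ((Real.sqrt (1 + l ^ 2) : ℂ) • (1 : Matrix (Fin 2) (Fin 2) ℂ) +
            (l : ℂ) • tau3) * R =
          ε • ((Real.sqrt (1 + l ^ 2) : ℂ) • (1 : Matrix (Fin 2) (Fin 2) ℂ) +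
            (l : ℂ) • tau3)) ↔
    (R.IsDiag ∧ ∃ ε : ℂ, (ε = 1 ∨ ε = -1) ∧ L = ε • R⁻¹) := by
  have hRunit : IsUnit R.det := by rw [hRdet]; exact isUnit_one
  rw [smul_one_add_smul_tau3]
  set s : ℝ := Real.sqrt (1 + l ^ 2) with hs
  have hspos : 0 < s := Real.sqrt_pos.mpr (by positivity)
  have hs2 : s ^ 2 = 1 + l ^ 2 := Real.sq_sqrt (by positivity)
  have hs2' : (s : ℂ) ^ 2 = 1 + (l : ℂ) ^ 2 := by exact_mod_cast hs2
  set d : Fin 2 → ℂ := ![(s : ℂ) + l, (s : ℂ) - l] with hd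
  have hdet : IsUnit (Matrix.diagonal d).det := by
    have hone : (Matrix.diagonal d).det = 1 := by
      simp only [Matrix.det_diagonal, Fin.prod_univ_two, hd, Matrix.cons_val_zero,
        Matrix.cons_val_one]
      linear_combination hs2'
    rw [hone]
    exact isUnit_one
  have hcomm : R.IsDiag → Matrix.diagonal d * R = R * Matrix.diagonal d := by
    intro hdiag
    rw [← hdiag.diagonal_diag]
    exact Matrix.commute_diagonal d R.diag
  constructor
  · rintro ⟨ε, hε, h⟩
    have hherm : (Matrix.diagonal d).IsHermitian := by
      rw [Matrix.isHermitian_diagonal_iff]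
      intro i
      fin_cases i <;> simp [hd, isSelfAdjoint_iff]
    have hdist : Function.Injective fun i => d i * d i := by
      have hne : ((s : ℂ) + l) * (s + l) ≠ (s - l) * (s - l) := by
        intro heq
        have hreal : (s + l) * (s + l) = (s - l) * (s - l) := by exact_mod_cast heq
        nlinarith [mul_pos hspos hl]
      intro i j hij
      fin_cases i <;> fin_cases j
      · rfl
      · exact absurd hij hne
      · exact absurd hij.symm hne
      · rfl
    have hdiag : R.IsDiag := by
      have hsq := commute_sq_of_unitary_mul_mul_eq hL hR hherm hε h
      rw [Matrix.diagonal_mul_diagonal] at hsq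
      exact isDiag_of_commute_diagonal hdist hsq
    refine ⟨hdiag, ε, hε, ?_⟩
    have hLR : L * R = ε • 1 := by
      rw [Matrix.mul_assoc, hcomm hdiag, ← Matrix.mul_assoc] at h
      rw [← Matrix.mul_nonsing_inv_cancel_right _ (L * R) hdet, h, Matrix.smul_mul,
        Matrix.mul_nonsing_inv _ hdet]
    rw [← Matrix.mul_nonsing_inv_cancel_right _ L hRunit, hLR, Matrix.smul_mul, Matrix.one_mul]
  · rintro ⟨hdiag, ε, hε, rfl⟩
    refine ⟨ε, hε, ?_⟩
    rw [Matrix.mul_assoc, hcomm hdiag, Matrix.smul_mul,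
      Matrix.nonsing_inv_mul_cancel_left _ _ hRunit]
end
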